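/- Let E be a σ-lattice (or complete lattice) effect algebra and define, for an observable x with spectrum in [0,1], x⁻ := f(x) where f(t) = 1 - t. Then: (i) x ⪯ y implies y⁻ ⪯ x⁻; (ii) x⁻⁻ = x; (iii) (q_a)⁻ = q_{a'} for each a ∈ E. Hence the observables with spectrum in [0,1] form an involution lattice under the Olson order. -/

import Mathlib

structure EffectAlgebra (E : Type*) where
  add : E → E → Option E
  zero : E
  one : E
  comm : ∀ a b, add a b = add b a
  assoc : ∀ a b c, (add a b).bind (fun d => add d c) = (add b c).bind (fun d => add a d)
  orth : ∀ a : E, ∃! b, add a b = some one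
  pos_one : ∀ a b, add a one = some b → a = zero

namespace EffectAlgebra

variable {E : Type*}

/-- The induced order: `a ≤ b` iff `a + c = b` for some `c`. -/
def le (EA : EffectAlgebra E) (a b : E) : Prop := ∃ c, EA.add a c = some b

/-- The orthosupplement `a'`, the unique element with `a + a' = 1`. -/
noncomputable def orthosupp (EA : EffectAlgebra E) (a : E) : E :=
  Classical.choose (EA.orth a).exists

/-- `s` is the supremum of `S` with respect to the induced order. -/
def IsSup (EA : EffectAlgebra E) (S : Set E) (s : E) : Prop :=
  (∀ x ∈ S, EA.le x s) ∧ ∀ b, (∀ x ∈ S, EA.le x b) → EA.le s b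

/-- `s` is the infimum of `S` with respect to the induced order. -/
def IsInf (EA : EffectAlgebra E) (S : Set E) (s : E) : Prop :=
  (∀ x ∈ S, EA.le s x) ∧ ∀ b, (∀ x ∈ S, EA.le b x) → EA.le b s

/-- Every increasing sequence has a supremum. -/
def MonotoneSigmaComplete (EA : EffectAlgebra E) : Prop :=
  ∀ f : ℕ → E, (∀ n, EA.le (f n) (f (n + 1))) → ∃ s, EA.IsSup (Set.range f) s

/-- A σ-lattice effect algebra: countable suprema and infima exist. -/
def SigmaLattice (EA : EffectAlgebra E) : Prop :=
  (∀ f : ℕ → E, ∃ s, EA.IsSup (Set.range f) s) ∧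
  (∀ f : ℕ → E, ∃ s, EA.IsInf (Set.range f) s)

/-- A complete lattice effect algebra: arbitrary suprema and infima exist. -/
def CompleteEA (EA : EffectAlgebra E) : Prop :=
  (∀ S : Set E, ∃ s, EA.IsSup S s) ∧ (∀ S : Set E, ∃ s, EA.IsInf S s)

/-- A lattice effect algebra: binary suprema and infima exist. -/
def LatticeEA (EA : EffectAlgebra E) : Prop :=
  (∀ a b : E, ∃ s, EA.IsSup {a, b} s) ∧ (∀ a b : E, ∃ s, EA.IsInf {a, b} s)

end EffectAlgebra

/-- Borel subsets of the real line. -/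
abbrev BorelSet := {A : Set ℝ // MeasurableSet A}

def bIio (t : ℝ) : BorelSet := ⟨Set.Iio t, measurableSet_Iio⟩
def bIic (t : ℝ) : BorelSet := ⟨Set.Iic t, measurableSet_Iic⟩

/-- An observable on a (monotone σ-complete) effect algebra: a unital,
additive map on the Borel σ-algebra preserving suprema of increasing sequences. -/
structure Observable {E : Type*} (EA : EffectAlgebra E) where
  toFun : BorelSet → E
  unital : toFun ⟨Set.univ, MeasurableSet.univ⟩ = EA.one
  additive : ∀ A B : BorelSet, Disjoint A.1 B.1 →
    EA.add (toFun A) (toFun B) = some (toFun ⟨A.1 ∪ B.1, A.2.union B.2⟩)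
  sup_cont : ∀ f : ℕ → BorelSet, (∀ n, (f n).1 ⊆ (f (n + 1)).1) →
    EA.IsSup (Set.range fun n => toFun (f n))
      (toFun ⟨⋃ n, (f n).1, MeasurableSet.iUnion (fun n => (f n).2)⟩)

namespace Observable

variable {E : Type*} {EA : EffectAlgebra E}

/-- The Olson (spectral) order on observables. -/
def OlsonLe (x y : Observable EA) : Prop :=
  ∀ t : ℝ, EA.le (y.toFun (bIio t)) (x.toFun (bIio t))

/-- An observable is bounded if `x(C) = 1` for some compact set `C`. -/
def Bounded (x : Observable EA) : Prop :=
  ∃ C : Set ℝ, ∃ hC : IsCompact C, x.toFun ⟨C, hC.measurableSet⟩ = EA.one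

/-- `x` is the question observable `q_a` of the element `a`. -/
def IsQuestion (x : Observable EA) (a : E) : Prop :=
  ∀ t : ℝ, x.toFun (bIio t) =
    if t ≤ 0 then EA.zero else if t ≤ 1 then EA.orthosupp a else EA.one

/-- The spectrum of `x` lies in `[0,1]`. -/
def SpectrumIn01 (x : Observable EA) : Prop :=
  x.toFun ⟨Set.Icc 0 1, measurableSet_Icc⟩ = EA.one

/-- `z` is the infimum of `S` in the Olson order on bounded observables. -/
def IsOlsonInf (S : Set (Observable EA)) (z : Observable EA) : Prop :=
  z.Bounded ∧ (∀ x ∈ S, z.OlsonLe x) ∧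
    ∀ w : Observable EA, w.Bounded → (∀ x ∈ S, w.OlsonLe x) → w.OlsonLe z

/-- `z` is the supremum of `S` in the Olson order on bounded observables. -/
def IsOlsonSup (S : Set (Observable EA)) (z : Observable EA) : Prop :=
  z.Bounded ∧ (∀ x ∈ S, x.OlsonLe z) ∧
    ∀ w : Observable EA, w.Bounded → (∀ x ∈ S, x.OlsonLe w) → z.OlsonLe w

end Observable

/-- A spectral resolution: monotone, with infimum 0, supremum 1, left continuous. -/
def SpectralResolution {E : Type*} (EA : EffectAlgebra E) (F : ℝ → E) : Prop :=
  (∀ t s : ℝ, t < s → EA.le (F t) (F s)) ∧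
  EA.IsInf (Set.range F) EA.zero ∧
  EA.IsSup (Set.range F) EA.one ∧
  ∀ s : ℝ, EA.IsSup (F '' Set.Iio s) (F s)

/-- Preimage of a Borel set under `t ↦ 1 - t`. -/
def negSet (A : BorelSet) : BorelSet :=
  ⟨(fun t : ℝ => 1 - t) ⁻¹' A.1, (measurable_const.sub measurable_id) A.2⟩

/-- `nx = x⁻ = f(x)` where `f(t) = 1 - t`. -/
def IsNeg {E : Type*} {EA : EffectAlgebra E} (nx x : Observable EA) : Prop :=
  ∀ A : BorelSet, nx.toFun A = x.toFun (negSet A)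

namespace EffectAlgebra

variable {E : Type*} (EA : EffectAlgebra E)

lemma add_assoc_left {a b c d e : E} (h : EA.add a b = some d) (h' : EA.add d c = some e) :
    ∃ f, EA.add b c = some f ∧ EA.add a f = some e := by
  have := EA.assoc a b c
  rw [h, Option.bind_some, h'] at this
  exact Option.bind_eq_some_iff.1 this.symm

lemma add_orthosupp (a : E) : EA.add a (EA.orthosupp a) = some EA.one :=
  Classical.choose_spec (EA.orth a).exists

lemma eq_orthosupp {a b : E} (h : EA.add a b = some EA.one) : b = EA.orthosupp a :=
  (EA.orth a).unique h (EA.add_orthosupp a)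

lemma orthosupp_orthosupp (a : E) : EA.orthosupp (EA.orthosupp a) = a :=
  (EA.eq_orthosupp (by rw [EA.comm, EA.add_orthosupp])).symm

lemma one_add_zero : EA.add EA.one EA.zero = some EA.one := by
  have h := EA.add_orthosupp EA.one
  have h0 := EA.pos_one _ _ ((EA.comm _ _).trans h)
  rwa [h0] at h

lemma orthosupp_one : EA.orthosupp EA.one = EA.zero :=
  (EA.eq_orthosupp EA.one_add_zero).symm

lemma orthosupp_zero : EA.orthosupp EA.zero = EA.one := by
  rw [← EA.orthosupp_one, EA.orthosupp_orthosupp]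

lemma add_zero (a : E) : EA.add a EA.zero = some a := by
  obtain ⟨f, hf, hf'⟩ := EA.add_assoc_left
    ((EA.comm _ _).trans (EA.add_orthosupp a)) EA.one_add_zero
  rw [hf, EA.eq_orthosupp hf', EA.orthosupp_orthosupp]

lemma le_refl (a : E) : EA.le a a := ⟨_, EA.add_zero a⟩

lemma le_trans {a b c : E} (hab : EA.le a b) (hbc : EA.le b c) : EA.le a c := by
  obtain ⟨d, hd⟩ := hab
  obtain ⟨e, he⟩ := hbc
  obtain ⟨f, -, hf⟩ := EA.add_assoc_left hd he
  exact ⟨f, hf⟩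

lemma eq_zero_of_add_eq_self {a e : E} (h : EA.add a e = some a) : e = EA.zero := by
  have h1 : EA.add (EA.orthosupp a) a = some EA.one :=
    (EA.comm _ _).trans (EA.add_orthosupp a)
  have h2 := EA.assoc (EA.orthosupp a) a e
  rw [h1, h, Option.bind_some, Option.bind_some, h1] at h2
  exact EA.pos_one _ _ ((EA.comm _ _).trans h2)

lemma eq_zero_of_add_eq_zero {c d : E} (h : EA.add c d = some EA.zero) : d = EA.zero := by
  obtain ⟨f, hf, -⟩ := EA.add_assoc_left h ((EA.comm _ _).trans EA.one_add_zero)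
  exact EA.pos_one _ _ hf

lemma le_antisymm {a b : E} (hab : EA.le a b) (hba : EA.le b a) : a = b := by
  obtain ⟨c, hc⟩ := hab
  obtain ⟨d, hd⟩ := hba
  obtain ⟨e, he, hae⟩ := EA.add_assoc_left hc hd
  rw [EA.eq_zero_of_add_eq_self hae] at he
  rw [EA.eq_zero_of_add_eq_zero he, EA.add_zero] at hd
  exact (Option.some.inj hd).symm

lemma orthosupp_le_orthosupp {a b : E} (h : EA.le a b) :
    EA.le (EA.orthosupp b) (EA.orthosupp a) := by
  obtain ⟨c, hc⟩ := h
  obtain ⟨f, hf, hf'⟩ := EA.add_assoc_left hc (EA.add_orthosupp b)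
  exact ⟨c, by rw [EA.comm, hf, EA.eq_orthosupp hf']⟩

end EffectAlgebra

lemma negSet_negSet (A : BorelSet) : negSet (negSet A) = A := by
  ext t
  simp [negSet]

lemma negSet_bIio (t : ℝ) : negSet (bIio t) = ⟨Set.Ioi (1 - t), measurableSet_Ioi⟩ := by
  ext s
  simp only [negSet, bIio, Set.mem_preimage, Set.mem_Iio, Set.mem_Ioi]
  exact sub_lt_comm

namespace Observable

variable {E : Type*} {EA : EffectAlgebra E}

lemma toFun_injective : Function.Injective (toFun : Observable EA → BorelSet → E) := by
  rintro ⟨⟩ ⟨⟩ rfl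
  rfl

lemma toFun_Ici (x : Observable EA) (t : ℝ) :
    x.toFun ⟨Set.Ici t, measurableSet_Ici⟩ = EA.orthosupp (x.toFun (bIio t)) := by
  apply EA.eq_orthosupp
  rw [x.additive _ _ (Set.Iio_disjoint_Ici le_rfl), ← x.unital]
  simp only [bIio, Set.Iio_union_Ici]

/-- The value on `(s, ∞)` is the supremum of the values on `[s + δ / (n + 1), ∞)`. -/
lemma isSup_toFun_Ioi (x : Observable EA) (s : ℝ) {δ : ℝ} (hδ : 0 < δ) :
    EA.IsSup (Set.range fun n : ℕ => EA.orthosupp (x.toFun (bIio (s + δ / (n + 1)))))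
      (x.toFun ⟨Set.Ioi s, measurableSet_Ioi⟩) := by
  have h := x.sup_cont (fun n => ⟨Set.Ici (s + δ / (n + 1)), measurableSet_Ici⟩) fun n => by
    apply Set.Ici_subset_Ici.2
    push_cast
    gcongr
    linarith
  simp only [toFun_Ici] at h
  convert h using 3
  ext r
  simp only [Set.mem_Ioi, Set.mem_iUnion, Set.mem_Ici]
  constructor
  · intro hr
    obtain ⟨n, hn⟩ := exists_nat_gt (δ / (r - s))
    refine ⟨n, ?_⟩
    have hrs : 0 < r - s := sub_pos.2 hr
    rw [div_lt_iff₀ hrs] at hn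
    have : δ / (n + 1) ≤ r - s := by
      rw [div_le_iff₀ (by positivity)]
      linarith
    linarith
  · rintro ⟨n, hn⟩
    have : 0 < δ / ((n : ℝ) + 1) := by positivity
    linarith

lemma toFun_Ioi_eq_of_const (x : Observable EA) {s δ : ℝ} (hδ : 0 < δ) {c : E}
    (h : ∀ t, s < t → t ≤ s + δ → x.toFun (bIio t) = c) :
    x.toFun ⟨Set.Ioi s, measurableSet_Ioi⟩ = EA.orthosupp c := by
  have hsup := x.isSup_toFun_Ioi s hδ
  have hc : ∀ n : ℕ, x.toFun (bIio (s + δ / (n + 1))) = c := fun n => by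
    refine h _ (lt_add_of_pos_right s (by positivity)) ?_
    gcongr
    exact div_le_self hδ.le (by simp)
  simp only [hc, Set.range_const] at hsup
  refine EA.le_antisymm (hsup.2 _ ?_) (hsup.1 _ rfl)
  rintro _ rfl
  exact EA.le_refl _

lemma OlsonLe.toFun_Ioi_le {x y : Observable EA} (h : x.OlsonLe y) (s : ℝ) :
    EA.le (x.toFun ⟨Set.Ioi s, measurableSet_Ioi⟩)
      (y.toFun ⟨Set.Ioi s, measurableSet_Ioi⟩) := by
  refine (x.isSup_toFun_Ioi s one_pos).2 _ ?_
  rintro _ ⟨n, rfl⟩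
  exact EA.le_trans (EA.orthosupp_le_orthosupp (h _))
    ((y.isSup_toFun_Ioi s one_pos).1 _ ⟨n, rfl⟩)

end Observable

/-- for observables with spectrum in `[0,1]`, the negation
`x⁻ := f(x)` with `f(t) = 1 - t` satisfies: (i) contraposition w.r.t. the Olson
order; (ii) double negation `x⁻⁻ = x`; (iii) `(q_a)⁻ = q_{a'}`. Hence the
observables with spectrum in `[0,1]` form an involution lattice. -/
theorem stmt17 {E : Type*} (EA : EffectAlgebra E) (hE : EA.SigmaLattice) :
    (∀ x y nx ny : Observable EA, x.SpectrumIn01 → y.SpectrumIn01 →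
      IsNeg nx x → IsNeg ny y → x.OlsonLe y → ny.OlsonLe nx) ∧
    (∀ x nx nnx : Observable EA, x.SpectrumIn01 →
      IsNeg nx x → IsNeg nnx nx → nnx = x) ∧
    (∀ (a : E) (qa nqa : Observable EA), qa.IsQuestion a → IsNeg nqa qa →
      nqa.IsQuestion (EA.orthosupp a)) := by
  refine ⟨?_, ?_, ?_⟩
  · intro x y nx ny _ _ hnx hny hxy t
    rw [hnx, hny, negSet_bIio]
    exact hxy.toFun_Ioi_le _
  · intro x nx nnx _ hnx hnnx
    refine Observable.toFun_injective (funext fun A => ?_)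
    rw [hnnx, hnx, negSet_negSet]
  · intro a qa nqa hqa hnqa t
    rw [hnqa, negSet_bIio]
    split_ifs with h0 h1
    · rw [qa.toFun_Ioi_eq_of_const one_pos (c := EA.one), EA.orthosupp_one]
      intro r hr _
      rw [hqa, if_neg (by linarith), if_neg (by linarith)]
    · apply qa.toFun_Ioi_eq_of_const (not_le.1 h0)
      intro r hr hr'
      rw [hqa, if_neg (by linarith), if_pos (by linarith)]
    · rw [qa.toFun_Ioi_eq_of_const (sub_pos.2 (not_le.1 h1)) (c := EA.zero),
        EA.orthosupp_zero]
      intro r _ hr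
      rw [hqa, if_pos (by linarith)]
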